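/- Let L be a domain and let E be a quasisober topological space. Every L-valued tight weakly outer-continuous maxitive measure on the Borel σ-algebra ℬ of E is 𝒬-smooth, 𝓕-smooth, and saturated. -/

import Mathlib

open Set

universe u v

section OrderDefs
variable {L : Type u} [PartialOrder L]

/-- A filtered (nonempty, downward directed) subset of a poset. -/
def DirFiltered (F : Set L) : Prop :=
  F.Nonempty ∧ ∀ r ∈ F, ∀ s ∈ F, ∃ t ∈ F, t ≤ r ∧ t ≤ s

/-- A filter of a poset: a filtered upper set. -/
def OrdFilter (F : Set L) : Prop :=
  DirFiltered F ∧ ∀ r ∈ F, ∀ s : L, r ≤ s → s ∈ F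

/-- Every filter has an infimum. -/
def FilteredComplete (L : Type u) [PartialOrder L] : Prop :=
  ∀ F : Set L, OrdFilter F → ∃ i : L, IsGLB F i

/-- `s` is way-above `r`: for every filter `F` with an infimum below `r`, `s ∈ F`. -/
def WayAbove (s r : L) : Prop :=
  ∀ F : Set L, OrdFilter F → ∀ i : L, IsGLB F i → i ≤ r → s ∈ F

/-- The poset is continuous: for every `r`, the set of elements way-above `r`
is a filter whose infimum is `r`. -/
def ContinuousPoset (L : Type u) [PartialOrder L] : Prop :=
  ∀ r : L, OrdFilter {s : L | WayAbove s r} ∧ IsGLB {s : L | WayAbove s r} r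

/-- Conditional completeness: every nonempty set bounded above has a supremum. -/
def CondComplete (L : Type u) [PartialOrder L] : Prop :=
  ∀ S : Set L, S.Nonempty → BddAbove S → ∃ m : L, IsLUB S m

end OrderDefs

/-- A domain: a filtered-complete continuous poset with a least element. -/
def DomainPoset (L : Type u) [PartialOrder L] [OrderBot L] : Prop :=
  FilteredComplete L ∧ ContinuousPoset L

section TopDefs
variable {E : Type v} [TopologicalSpace E]

/-- The saturation of a set: intersection of all open sets containing it. -/
def satur (A : Set E) : Set E := ⋂₀ {G : Set E | IsOpen G ∧ A ⊆ G}

/-- A set is saturated if it is an intersection of open sets. -/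
def IsSatur (A : Set E) : Prop :=
  ∃ 𝒢 : Set (Set E), (∀ G ∈ 𝒢, IsOpen G) ∧ A = ⋂₀ 𝒢

/-- The collection 𝒬 of compact saturated subsets. -/
def CompactSat (E : Type v) [TopologicalSpace E] : Set (Set E) :=
  {A : Set E | IsCompact A ∧ IsSatur A}

/-- The Borel σ-algebra generated by open sets and compact saturated sets. -/
def BorelM (E : Type v) [TopologicalSpace E] : MeasurableSpace E :=
  MeasurableSpace.generateFrom ({A : Set E | IsOpen A} ∪ CompactSat E)

/-- Borel subsets for the σ-algebra generated by opens and compact saturated sets. -/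
def IsBorelSet (B : Set E) : Prop := @MeasurableSet E (BorelM E) B

/-- The collection 𝒦 of compact Borel subsets. -/
def CompactBorel (E : Type v) [TopologicalSpace E] : Set (Set E) :=
  {A : Set E | IsBorelSet A ∧ IsCompact A}

/-- `[x]` : the compact Borel set `↑{x} ∩ closure {x}`. -/
def ptClass (x : E) : Set E := satur {x} ∩ closure {x}

end TopDefs

section MeasDefs
variable {L : Type u} {E : Type v} [PartialOrder L] [OrderBot L] [TopologicalSpace E]

/-- An L-valued maxitive measure on the Borel σ-algebra. -/
def Maxitive (ν : Set E → L) : Prop :=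
  ν ∅ = ⊥ ∧ ∀ 𝒞 : Set (Set E), 𝒞.Finite → (∀ B ∈ 𝒞, IsBorelSet B) →
    IsLUB (ν '' 𝒞) (ν (⋃₀ 𝒞))

/-- σ-maxitivity. -/
def SigmaMaxitive (ν : Set E → L) : Prop :=
  Maxitive ν ∧ ∀ 𝒞 : Set (Set E), 𝒞.Countable → (∀ B ∈ 𝒞, IsBorelSet B) →
    IsLUB (ν '' 𝒞) (ν (⋃₀ 𝒞))

/-- Complete maxitivity. -/
def CompletelyMaxitive (ν : Set E → L) : Prop :=
  Maxitive ν ∧ ∀ 𝒞 : Set (Set E), (∀ B ∈ 𝒞, IsBorelSet B) → IsBorelSet (⋃₀ 𝒞) →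
    IsLUB (ν '' 𝒞) (ν (⋃₀ 𝒞))

/-- The set `{ν G : G open, G ⊇ B}`. -/
def outerVals (ν : Set E → L) (B : Set E) : Set L :=
  {l : L | ∃ G : Set E, IsOpen G ∧ B ⊆ G ∧ ν G = l}

/-- `νp` is the map `ν⁺ : B ↦ inf {ν G : G open, G ⊇ B}` on Borel sets. -/
def IsNuPlus (ν νp : Set E → L) : Prop :=
  ∀ B : Set E, IsBorelSet B → IsGLB (outerVals ν B) (νp B)

/-- Outer-continuity. -/
def OuterContinuous (ν : Set E → L) : Prop :=
  ∀ B : Set E, IsBorelSet B → IsGLB (outerVals ν B) (ν B)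

/-- Inner-continuity. -/
def InnerContinuous (ν : Set E → L) : Prop :=
  ∀ B : Set E, IsBorelSet B →
    IsLUB {l : L | ∃ K : Set E, IsBorelSet K ∧ IsCompact K ∧ K ⊆ B ∧ ν (satur K) = l} (ν B)

/-- Regularity: inner- and outer-continuity. -/
def RegularMeasure (ν : Set E → L) : Prop :=
  InnerContinuous ν ∧ OuterContinuous ν

/-- Weak outer-continuity: `ν K = ν⁺ K` for every compact Borel `K`. -/
def WeaklyOuterContinuous (ν : Set E → L) : Prop :=
  ∀ K : Set E, IsBorelSet K → IsCompact K → IsGLB (outerVals ν K) (ν K)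

/-- Weak inner-continuity (relative to a given `ν⁺ = νp`). -/
def WeaklyInnerContinuous (ν νp : Set E → L) : Prop :=
  ∀ G : Set E, IsOpen G →
    IsLUB {l : L | ∃ K : Set E, IsBorelSet K ∧ IsCompact K ∧ K ⊆ G ∧ νp K = l} (ν G)

/-- 𝒜-smoothness. -/
def SmoothWrt (ν : Set E → L) (𝒜 : Set (Set E)) : Prop :=
  ∀ 𝒟 : Set (Set E), 𝒟.Nonempty → 𝒟 ⊆ 𝒜 → DirectedOn (· ⊇ ·) 𝒟 →
    IsGLB (ν '' 𝒟) (ν (⋂₀ 𝒟))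

/-- Saturation of a maxitive measure: `ν K = ν (↑K)` for compact Borel `K`. -/
def SaturatedMeasure (ν : Set E → L) : Prop :=
  ∀ K : Set E, IsBorelSet K → IsCompact K → ν K = ν (satur K)

/-- Tightness: `inf {ν (E ∖ K) : K compact Borel} = 0`. -/
def TightMeasure (ν : Set E → L) : Prop :=
  IsGLB {l : L | ∃ K : Set E, IsBorelSet K ∧ IsCompact K ∧ ν Kᶜ = l} (⊥ : L)

/-- `c` is a cardinal density of `ν`. -/
def IsCardinalDensity (ν : Set E → L) (c : E → L) : Prop :=
  ∀ B : Set E, IsBorelSet B → IsLUB (c '' B) (ν B)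

/-- Upper semicontinuity of a map into the poset. -/
def UscMap (c : E → L) : Prop := ∀ t : L, IsOpen {x : E | WayAbove t (c x)}

/-- Upper compactness of a map into the poset. -/
def UpperCompactMap (c : E → L) : Prop :=
  ∀ t : L, WayAbove t (⊥ : L) → IsCompact {x : E | ¬ WayAbove t (c x)}

/-- Continuity from above along decreasing sequences of Borel sets. -/
def ContinuousFromAbove (ν : Set E → L) : Prop :=
  ∀ B : ℕ → Set E, (∀ n, IsBorelSet (B n)) → (∀ n, B (n + 1) ⊆ B n) →
    IsGLB (Set.range fun n => ν (B n)) (ν (⋂ n, B n))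

/-- An optimal measure: a σ-maxitive measure continuous from above. -/
def OptimalMeasure (ν : Set E → L) : Prop :=
  SigmaMaxitive ν ∧ ContinuousFromAbove ν

/-- `flo` is the regular part `⌊ν⌋` (relative to `νp = ν⁺`):
`⌊ν⌋(B) = sup {ν⁺(K) : K compact Borel, K ⊆ B}`. -/
def RegPartRel (νp flo : Set E → L) : Prop :=
  ∀ B : Set E, IsBorelSet B →
    IsLUB {l : L | ∃ K : Set E, IsBorelSet K ∧ IsCompact K ∧ K ⊆ B ∧ νp K = l} (flo B)

end MeasDefs

theorem WayAbove.exists_le_of_isGLB {L : Type u} [PartialOrder L] {s r i : L}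
    (h : WayAbove s r) {S : Set L} (hS : DirFiltered S) (hi : IsGLB S i) (hir : i ≤ r) : ∃ t ∈ S, t ≤ s := by
  refine h {s | ∃ t ∈ S, t ≤ s} ⟨⟨?_, ?_⟩, ?_⟩ i ⟨?_, ?_⟩ hir
  · obtain ⟨t, ht⟩ := hS.1
    exact ⟨t, t, ht, le_rfl⟩
  · rintro a ⟨t, ht, hta⟩ b ⟨t', ht', htb⟩
    obtain ⟨w, hw, hwt, hwt'⟩ := hS.2 t ht t' ht'
    exact ⟨w, ⟨w, hw, le_rfl⟩, hwt.trans hta, hwt'.trans htb⟩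
  · rintro a ⟨t, ht, hta⟩ b hab
    exact ⟨t, ht, hta.trans hab⟩
  · rintro a ⟨t, ht, hta⟩
    exact (hi.1 ht).trans hta
  · exact fun l hl => hi.2 fun t ht => hl ⟨t, ht, le_rfl⟩

section Saturation
variable {E : Type v} [TopologicalSpace E]

theorem subset_satur (A : Set E) : A ⊆ satur A :=
  subset_sInter fun _ hG => hG.2

theorem satur_subset_iff {A G : Set E} (hG : IsOpen G) : satur A ⊆ G ↔ A ⊆ G :=
  ⟨(subset_satur A).trans, fun h => sInter_subset_of_mem ⟨hG, h⟩⟩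

theorem isSatur_satur (A : Set E) : IsSatur (satur A) :=
  ⟨_, fun _ hG => hG.1, rfl⟩

theorem IsSatur.sInter {𝒟 : Set (Set E)} (h : ∀ D ∈ 𝒟, IsSatur D) : IsSatur (⋂₀ 𝒟) := by
  refine ⟨{G | IsOpen G ∧ ⋂₀ 𝒟 ⊆ G}, fun G hG => hG.1,
    (subset_sInter fun G hG => hG.2).antisymm (subset_sInter fun D hD => ?_)⟩
  obtain ⟨𝒢, h𝒢, rfl⟩ := h D hD
  exact subset_sInter fun G hG =>
    sInter_subset_of_mem ⟨h𝒢 G hG, (sInter_subset_of_mem hD).trans (sInter_subset_of_mem hG)⟩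

theorem IsSatur.mem_of_specializes {A : Set E} (hA : IsSatur A) {x y : E} (h : x ⤳ y)
    (hy : y ∈ A) : x ∈ A := by
  obtain ⟨𝒢, h𝒢, rfl⟩ := hA
  exact fun G hG => h.mem_open (h𝒢 G hG) (hy G hG)

theorem isCompact_satur {K : Set E} (hK : IsCompact K) : IsCompact (satur K) := by
  refine isCompact_of_finite_subcover fun U hU hKU => ?_
  obtain ⟨t, ht⟩ := hK.elim_finite_subcover U hU ((subset_satur K).trans hKU)
  exact ⟨t, (satur_subset_iff (isOpen_biUnion fun i _ => hU i)).2 ht⟩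

/-- A quasisober space is well-filtered: if the intersection of a filtered family of compact
saturated sets lies in an open set, then so does some member of the family. -/
theorem exists_subset_of_sInter_subset_of_compactSat [QuasiSober E] {𝒟 : Set (Set E)}
    (hne : 𝒟.Nonempty) (h𝒟 : 𝒟 ⊆ CompactSat E) (hdir : DirectedOn (· ⊇ ·) 𝒟)
    {G : Set E} (hG : IsOpen G) (hsub : ⋂₀ 𝒟 ⊆ G) : ∃ D ∈ 𝒟, D ⊆ G := by
  by_contra! hcon
  let S : Set (Set E) := {C | IsClosed C ∧ C ⊆ Gᶜ ∧ ∀ D ∈ 𝒟, (D ∩ C).Nonempty}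
  obtain ⟨C, ⟨hCc, hCG, hC𝒟⟩, hmin⟩ : ∃ C, Minimal (· ∈ S) C := by
    refine zorn_superset S fun c hcS hc => ?_
    rcases c.eq_empty_or_nonempty with rfl | hcne
    · refine ⟨Gᶜ, ⟨hG.isClosed_compl, subset_rfl, fun D hD => ?_⟩, by simp⟩
      exact inter_compl_nonempty_iff.2 (hcon D hD)
    · refine ⟨⋂₀ c, ⟨isClosed_sInter fun C hC => (hcS hC).1, ?_, fun D hD => ?_⟩,
        fun C hC => sInter_subset_of_mem hC⟩
      · obtain ⟨C, hC⟩ := hcne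
        exact (sInter_subset_of_mem hC).trans (hcS hC).2.1
      · by_contra hemp
        rw [not_nonempty_iff_eq_empty, sInter_eq_iInter] at hemp
        have := hcne.to_subtype
        obtain ⟨C, hC⟩ := (h𝒟 hD).1.elim_directed_family_closed
          (fun C : c => (C : Set E)) (fun C => (hcS C.2).1) hemp
          fun A B => (hc.total A.2 B.2).elim (fun h => ⟨A, subset_rfl, h⟩)
            fun h => ⟨B, h, subset_rfl⟩
        exact ((hcS C.2).2.2 D hD).ne_empty hC
  have hproper : ∀ A : Set E, IsClosed A → ¬ C ⊆ A → ∃ D ∈ 𝒟, D ∩ (C ∩ A) = ∅ := by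
    intro A hA hCA
    by_contra! h
    exact hCA ((hmin ⟨hCc.inter hA, inter_subset_left.trans hCG, h⟩
      inter_subset_left).trans inter_subset_right)
  have hirr : IsIrreducible C := by
    obtain ⟨D, hD⟩ := hne
    refine ⟨(hC𝒟 D hD).mono inter_subset_right,
      isPreirreducible_iff_isClosed_union_isClosed.2 fun A B hA hB hAB => ?_⟩
    by_contra! h
    obtain ⟨D₁, hD₁, h₁⟩ := hproper A hA h.1
    obtain ⟨D₂, hD₂, h₂⟩ := hproper B hB h.2
    obtain ⟨D₃, hD₃, h₃₁, h₃₂⟩ := hdir D₁ hD₁ D₂ hD₂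
    obtain ⟨x, hx, hxC⟩ := hC𝒟 D₃ hD₃
    rcases hAB hxC with hxA | hxB
    · exact h₁.subset ⟨h₃₁ hx, hxC, hxA⟩
    · exact h₂.subset ⟨h₃₂ hx, hxC, hxB⟩
  obtain ⟨x, hx⟩ := QuasiSober.sober hirr hCc
  refine hCG hx.mem (hsub fun D hD => ?_)
  obtain ⟨y, hyD, hyC⟩ := hC𝒟 D hD
  exact (h𝒟 hD).2.mem_of_specializes (hx.specializes hyC) hyD

theorem sInter_mem_compactSat [QuasiSober E] {𝒟 : Set (Set E)}
    (hne : 𝒟.Nonempty) (h𝒟 : 𝒟 ⊆ CompactSat E) (hdir : DirectedOn (· ⊇ ·) 𝒟) :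
    ⋂₀ 𝒟 ∈ CompactSat E := by
  refine ⟨isCompact_of_finite_subcover fun U hU hsub => ?_, .sInter fun D hD => (h𝒟 hD).2⟩
  obtain ⟨D, hD, hDU⟩ :=
    exists_subset_of_sInter_subset_of_compactSat hne h𝒟 hdir (isOpen_iUnion hU) hsub
  obtain ⟨t, ht⟩ := (h𝒟 hD).1.elim_finite_subcover U hU hDU
  exact ⟨t, (sInter_subset_of_mem hD).trans ht⟩

/-- The trace on a compact set of a filtered family of closed sets is eventually contained in
any open set containing the trace of the intersection. -/
theorem IsCompact.exists_inter_subset_of_sInter_inter_subset {K : Set E} (hK : IsCompact K)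
    {𝒟 : Set (Set E)} (hne : 𝒟.Nonempty) (h𝒟 : ∀ D ∈ 𝒟, IsClosed D)
    (hdir : DirectedOn (· ⊇ ·) 𝒟) {G : Set E} (hG : IsOpen G) (hsub : ⋂₀ 𝒟 ∩ K ⊆ G) :
    ∃ D ∈ 𝒟, D ∩ K ⊆ G := by
  have := hne.to_subtype
  obtain ⟨D, hD⟩ := (hK.diff hG).elim_directed_family_closed
    (fun D : 𝒟 => (D : Set E)) (fun D => h𝒟 D D.2) (by
      rw [← sInter_eq_iInter]
      exact eq_empty_of_forall_notMem fun x hx => hx.1.2 (hsub ⟨hx.2, hx.1.1⟩))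
    hdir.directed_val
  refine ⟨D, D.2, fun x hx => ?_⟩
  by_contra hxG
  exact hD.subset ⟨⟨hx.2, hxG⟩, hx.1⟩

theorem IsOpen.isBorelSet {G : Set E} (hG : IsOpen G) : IsBorelSet G :=
  MeasurableSpace.measurableSet_generateFrom (Or.inl hG)

theorem IsClosed.isBorelSet {F : Set E} (hF : IsClosed F) : IsBorelSet F :=
  @MeasurableSet.of_compl _ _ (BorelM E) hF.isOpen_compl.isBorelSet

theorem isBorelSet_of_mem_compactSat {Q : Set E} (hQ : Q ∈ CompactSat E) : IsBorelSet Q :=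
  MeasurableSpace.measurableSet_generateFrom (Or.inr hQ)

end Saturation

theorem WeaklyOuterContinuous.saturatedMeasure {L : Type u} [PartialOrder L]
    {E : Type v} [TopologicalSpace E] {ν : Set E → L} (hwoc : WeaklyOuterContinuous ν) :
    SaturatedMeasure ν := by
  intro K hKB hK
  have hs : satur K ∈ CompactSat E := ⟨isCompact_satur hK, isSatur_satur K⟩
  have heq : outerVals ν (satur K) = outerVals ν K := by
    ext l
    exact exists_congr fun G => and_congr_right fun hG => and_congr_left' (satur_subset_iff hG)
  refine (hwoc K hKB hK).unique ?_
  rw [← heq]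
  exact hwoc _ (isBorelSet_of_mem_compactSat hs) hs.1

section Measures
variable {L : Type u} {E : Type v} [PartialOrder L] [OrderBot L] [TopologicalSpace E]
  {ν : Set E → L}

theorem Maxitive.isLUB_union (hν : Maxitive ν) {A B : Set E} (hA : IsBorelSet A)
    (hB : IsBorelSet B) : IsLUB {ν A, ν B} (ν (A ∪ B)) := by
  have := hν.2 {A, B} (by simp) (by simp [hA, hB])
  rwa [image_pair, sUnion_pair] at this

theorem Maxitive.mono (hν : Maxitive ν) {A B : Set E} (hA : IsBorelSet A) (hB : IsBorelSet B)
    (h : A ⊆ B) : ν A ≤ ν B := by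
  have := (hν.isLUB_union hA hB).1 (mem_insert _ _)
  rwa [union_eq_self_of_subset_left h] at this

/-- A weakly outer-continuous maxitive measure commutes with the intersection of a family that
is eventually contained in every open neighbourhood of its compact intersection. -/
theorem WeaklyOuterContinuous.isGLB_image (hν : Maxitive ν) (hwoc : WeaklyOuterContinuous ν)
    {𝒟 : Set (Set E)} (h𝒟 : ∀ D ∈ 𝒟, IsBorelSet D) {A : Set E} (hAB : IsBorelSet A)
    (hA : IsCompact A) (hAD : ∀ D ∈ 𝒟, A ⊆ D)
    (hex : ∀ G, IsOpen G → A ⊆ G → ∃ D ∈ 𝒟, D ⊆ G) : IsGLB (ν '' 𝒟) (ν A) := by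
  constructor
  · rintro _ ⟨D, hD, rfl⟩
    exact hν.mono hAB (h𝒟 D hD) (hAD D hD)
  · refine fun l hl => (hwoc A hAB hA).2 ?_
    rintro _ ⟨G, hG, hAG, rfl⟩
    obtain ⟨D, hD, hDG⟩ := hex G hG hAG
    exact (hl ⟨D, hD, rfl⟩).trans (hν.mono (h𝒟 D hD) hG.isBorelSet hDG)

theorem WeaklyOuterContinuous.smoothWrt_compactSat [QuasiSober E] (hν : Maxitive ν)
    (hwoc : WeaklyOuterContinuous ν) : SmoothWrt ν (CompactSat E) := by
  intro 𝒟 hne h𝒟 hdir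
  have hmem := sInter_mem_compactSat hne h𝒟 hdir
  exact hwoc.isGLB_image hν (fun D hD => isBorelSet_of_mem_compactSat (h𝒟 hD))
    (isBorelSet_of_mem_compactSat hmem) hmem.1 (fun D hD => sInter_subset_of_mem hD)
    fun G hG => exists_subset_of_sInter_subset_of_compactSat hne h𝒟 hdir hG

theorem Maxitive.dirFiltered_compl_compactBorel (hν : Maxitive ν) :
    DirFiltered {l : L | ∃ K : Set E, IsBorelSet K ∧ IsCompact K ∧ ν Kᶜ = l} := by
  refine ⟨⟨_, ∅, isOpen_empty.isBorelSet, isCompact_empty, rfl⟩, ?_⟩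
  rintro _ ⟨K, hKB, hK, rfl⟩ _ ⟨K', hKB', hK', rfl⟩
  have hB : IsBorelSet (K ∪ K') := @MeasurableSet.union _ (BorelM E) _ _ hKB hKB'
  have hc : ∀ {A : Set E}, IsBorelSet A → IsBorelSet Aᶜ :=
    fun h => @MeasurableSet.compl _ _ (BorelM E) h
  exact ⟨_, ⟨K ∪ K', hB, hK.union hK', rfl⟩,
    hν.mono (hc hB) (hc hKB) (compl_subset_compl.2 subset_union_left),
    hν.mono (hc hB) (hc hKB') (compl_subset_compl.2 subset_union_right)⟩

theorem WeaklyOuterContinuous.smoothWrt_isClosed (hL : ContinuousPoset L) (hν : Maxitive ν)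
    (ht : TightMeasure ν) (hwoc : WeaklyOuterContinuous ν) :
    SmoothWrt ν {A : Set E | IsClosed A} := by
  intro 𝒟 hne h𝒟 hdir
  have hF : IsClosed (⋂₀ 𝒟) := isClosed_sInter h𝒟
  constructor
  · rintro _ ⟨D, hD, rfl⟩
    exact hν.mono hF.isBorelSet (h𝒟 hD).isBorelSet (sInter_subset_of_mem hD)
  intro l hl
  refine (hL (ν (⋂₀ 𝒟))).2.2 fun s (hs : WayAbove s _) => ?_
  obtain ⟨_, ⟨K, hKB, hK, rfl⟩, hKs⟩ :=
    hs.exists_le_of_isGLB hν.dirFiltered_compl_compactBorel ht bot_le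
  have hB : ∀ {D : Set E}, IsClosed D → IsBorelSet (D ∩ K) :=
    fun h => @MeasurableSet.inter _ (BorelM E) _ _ h.isBorelSet hKB
  have hKc : IsBorelSet Kᶜ := @MeasurableSet.compl _ _ (BorelM E) hKB
  have hglb : IsGLB (ν '' ((· ∩ K) '' 𝒟)) (ν (⋂₀ 𝒟 ∩ K)) := by
    refine hwoc.isGLB_image hν ?_ (hB hF) (hK.inter_left hF) ?_ fun G hG hsub => ?_
    · exact forall_mem_image.2 fun D hD => hB (h𝒟 hD)
    · exact forall_mem_image.2 fun D hD => inter_subset_inter_left K (sInter_subset_of_mem hD)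
    · exact exists_mem_image.2
        (hK.exists_inter_subset_of_sInter_inter_subset hne h𝒟 hdir hG hsub)
  have hfilt : DirFiltered (ν '' ((· ∩ K) '' 𝒟)) := by
    refine ⟨(hne.image _).image _, ?_⟩
    rintro _ ⟨_, ⟨D₁, hD₁, rfl⟩, rfl⟩ _ ⟨_, ⟨D₂, hD₂, rfl⟩, rfl⟩
    obtain ⟨D₃, hD₃, h₁, h₂⟩ := hdir D₁ hD₁ D₂ hD₂
    exact ⟨_, ⟨_, ⟨D₃, hD₃, rfl⟩, rfl⟩,
      hν.mono (hB (h𝒟 hD₃)) (hB (h𝒟 hD₁)) (inter_subset_inter_left K h₁),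
      hν.mono (hB (h𝒟 hD₃)) (hB (h𝒟 hD₂)) (inter_subset_inter_left K h₂)⟩
  obtain ⟨_, ⟨_, ⟨D, hD, rfl⟩, rfl⟩, hDs⟩ := hs.exists_le_of_isGLB hfilt hglb
    (hν.mono (hB hF) hF.isBorelSet inter_subset_left)
  have hsub : D ⊆ D ∩ K ∪ Kᶜ := fun x hx =>
    (em (x ∈ K)).imp (fun h => ⟨hx, h⟩) id
  calc l ≤ ν D := hl ⟨D, hD, rfl⟩
    _ ≤ ν (D ∩ K ∪ Kᶜ) := hν.mono (h𝒟 hD).isBorelSet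
      (@MeasurableSet.union _ (BorelM E) _ _ (hB (h𝒟 hD)) hKc) hsub
    _ ≤ s := (hν.isLUB_union (hB (h𝒟 hD)) hKc).2 (by simp [hDs, hKs])

end Measures

/-- on a quasisober space, every tight weakly outer-continuous
maxitive measure is 𝒬-smooth, 𝓕-smooth, and saturated. -/
theorem stmt8 {L : Type u} {E : Type v} [PartialOrder L] [OrderBot L]
    [TopologicalSpace E] [QuasiSober E] (hL : DomainPoset L)
    (ν : Set E → L) (hν : Maxitive ν)
    (ht : TightMeasure ν) (hwoc : WeaklyOuterContinuous ν) :
    SmoothWrt ν (CompactSat E) ∧ SmoothWrt ν {A : Set E | IsClosed A} ∧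
      SaturatedMeasure ν := by
  exact ⟨hwoc.smoothWrt_compactSat hν,
    hwoc.smoothWrt_isClosed hL.2 hν ht, hwoc.saturatedMeasure⟩
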